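/- For every m ≥ 1, the matrix Z = I + J, where I is the m×m identity matrix and J is the m×m all-ones matrix, lies in the interior of CS+^m (interior taken within the space S^m of real symmetric m×m matrices). -/

import Mathlib

open Matrix

/-- The completely positive semidefinite cone `CS+^m`. -/
def IsCSPlus {m : ℕ} (A : Matrix (Fin m) (Fin m) ℝ) : Prop :=
  ∃ d : ℕ, 1 ≤ d ∧ ∃ X : Fin m → Matrix (Fin d) (Fin d) ℝ,
    (∀ i, (X i).PosSemidef) ∧ ∀ i j, A i j = (X i * X j).trace

/-- A Gram matrix of entrywise nonnegative vectors (a completely positive matrix) lies in `CS+`. -/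
theorem isCSPlus_of_eq_sum_mul {m : ℕ} {K : Type*} [Fintype K] [Nonempty K]
    {A : Matrix (Fin m) (Fin m) ℝ} (x : K → Fin m → ℝ) (hx : ∀ k i, 0 ≤ x k i)
    (hA : ∀ i j, A i j = ∑ k, x k i * x k j) : IsCSPlus A := by
  refine ⟨Fintype.card K, Fintype.card_pos,
    fun i => diagonal fun k => x ((Fintype.equivFin K).symm k) i,
    fun i => PosSemidef.diagonal fun k => hx _ i, fun i j => ?_⟩
  rw [diagonal_mul_diagonal, trace_diagonal, hA]
  exact ((Fintype.equivFin K).symm.sum_comp fun k => x k i * x k j).symm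

/-- Weights `w` on pairs of indices for which
`B = c • J + ∑ k, ∑ l, w k l • (e k + e l) * (e k + e l)ᵀ`. -/
noncomputable def pairWeight {m : ℕ} (c : ℝ) (B : Matrix (Fin m) (Fin m) ℝ) (i j : Fin m) : ℝ :=
  if i = j then (B i i - c - ∑ l ∈ Finset.univ.erase i, (B i l - c)) / 4 else (B i j - c) / 2

theorem pairWeight_comm {m : ℕ} (c : ℝ) {B : Matrix (Fin m) (Fin m) ℝ} (hB : B.IsSymm)
    (i j : Fin m) : pairWeight c B i j = pairWeight c B j i := by
  rcases eq_or_ne i j with rfl | h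
  · rfl
  · simp only [pairWeight, if_neg h, if_neg h.symm, hB.apply i j]

theorem sum_pairWeight_mul {m : ℕ} (c : ℝ) {B : Matrix (Fin m) (Fin m) ℝ} (hB : B.IsSymm)
    (i j : Fin m) :
    ∑ k, ∑ l, pairWeight c B k l *
      (((if k = i then 1 else 0) + if l = i then 1 else 0) *
        ((if k = j then 1 else 0) + if l = j then 1 else 0)) = B i j - c := by
  have hsum : ∑ k, ∑ l, pairWeight c B k l *
      (((if k = i then 1 else 0) + if l = i then 1 else 0) *
        ((if k = j then 1 else 0) + if l = j then 1 else 0)) =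
      2 * pairWeight c B i j + 2 * if i = j then ∑ l, pairWeight c B i l else 0 := by
    simp only [mul_add, Finset.sum_add_distrib, mul_ite, mul_one, mul_zero, Finset.sum_ite_eq',
      Finset.mem_univ, if_true, Finset.sum_ite_irrel, Finset.sum_const_zero]
    rw [pairWeight_comm c hB j i]
    rcases eq_or_ne i j with rfl | h
    · simp only [if_true]
      rw [Finset.sum_congr rfl fun k _ => pairWeight_comm c hB k i]
      ring
    · simp [h, h.symm]
      ring
  rw [hsum]
  rcases eq_or_ne i j with rfl | h
  · have hoff : ∑ l ∈ Finset.univ.erase i, pairWeight c B i l =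
        (∑ l ∈ Finset.univ.erase i, (B i l - c)) / 2 := by
      rw [Finset.sum_div]
      refine Finset.sum_congr rfl fun l hl => ?_
      rw [pairWeight, if_neg (Finset.ne_of_mem_erase hl).symm]
    rw [if_pos rfl, ← Finset.add_sum_erase _ _ (Finset.mem_univ i), hoff, pairWeight, if_pos rfl]
    ring
  · rw [if_neg h, pairWeight, if_neg h]
    ring

theorem isCSPlus_of_pairWeight_nonneg {m : ℕ} {c : ℝ} (hc : 0 ≤ c)
    {B : Matrix (Fin m) (Fin m) ℝ} (hB : B.IsSymm) (hw : ∀ i j, 0 ≤ pairWeight c B i j) :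
    IsCSPlus B := by
  refine isCSPlus_of_eq_sum_mul (K := Option (Fin m × Fin m))
    (fun k i => k.elim √c fun p =>
      √(pairWeight c B p.1 p.2) * ((if p.1 = i then 1 else 0) + if p.2 = i then 1 else 0)) ?_ ?_
  · rintro (_ | p) i
    · exact Real.sqrt_nonneg c
    · dsimp only [Option.elim]
      positivity
  · intro i j
    have hsqrt (k l : Fin m) (a b : ℝ) :
        √(pairWeight c B k l) * a * (√(pairWeight c B k l) * b) = pairWeight c B k l * (a * b) := by
      rw [mul_mul_mul_comm, Real.mul_self_sqrt (hw k l)]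
    rw [Fintype.sum_option, Fintype.sum_prod_type]
    simp only [Option.elim, hsqrt, Real.mul_self_sqrt hc]
    rw [sum_pairWeight_mul c hB]
    ring

theorem continuous_pairWeight {m : ℕ} (c : ℝ) (i j : Fin m) :
    Continuous fun B : Matrix (Fin m) (Fin m) ℝ => pairWeight c B i j := by
  unfold pairWeight
  split_ifs <;> fun_prop

theorem pairWeight_one_add_ones_pos {m : ℕ} (hm : 1 ≤ m) (i j : Fin m) :
    0 < pairWeight (1 - 1 / (m : ℝ)) (1 + Matrix.of fun _ _ => (1 : ℝ)) i j := by
  have hm' : (0 : ℝ) < m := by exact_mod_cast hm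
  rcases eq_or_ne i j with rfl | h
  · have hoff : ∑ l ∈ Finset.univ.erase i,
        ((1 + Matrix.of fun _ _ => (1 : ℝ) : Matrix (Fin m) (Fin m) ℝ) i l - (1 - 1 / (m : ℝ))) =
        (m - 1) * (1 / (m : ℝ)) := by
      rw [Finset.sum_congr rfl (g := fun _ => 1 / (m : ℝ))]
      · simp [Finset.card_erase_of_mem, Nat.cast_sub hm]
      · intro l hl
        simp [Matrix.one_apply_ne (Finset.ne_of_mem_erase hl).symm]
    rw [pairWeight, if_pos rfl, hoff, Matrix.add_apply, Matrix.one_apply_eq, Matrix.of_apply]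
    have : (m : ℝ) * (1 / m) = 1 := by field_simp
    have : 0 < 1 / (m : ℝ) := by positivity
    linarith
  · rw [pairWeight, if_neg h, Matrix.add_apply, Matrix.one_apply_ne h, Matrix.of_apply]
    have : 0 < 1 / (m : ℝ) := by positivity
    linarith

/-- The matrix `Z = I + J` (identity plus all-ones) lies in the interior of `CS+^m`, taken
within the space of real symmetric `m×m` matrices. -/
theorem stmt11 (m : ℕ) (hm : 1 ≤ m) (Z : Matrix (Fin m) (Fin m) ℝ)
    (hZ : Z = 1 + Matrix.of (fun _ _ => (1 : ℝ))) (hsym : Z.IsSymm) :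
    (⟨Z, hsym⟩ : {B : Matrix (Fin m) (Fin m) ℝ // B.IsSymm}) ∈
      interior {B : {B : Matrix (Fin m) (Fin m) ℝ // B.IsSymm} | IsCSPlus B.val} := by
  have hc : (0 : ℝ) ≤ 1 - 1 / (m : ℝ) :=
    sub_nonneg.2 (div_le_one_of_le₀ (by exact_mod_cast hm) m.cast_nonneg)
  rw [mem_interior_iff_mem_nhds]
  have hpos : ∀ᶠ B : {B : Matrix (Fin m) (Fin m) ℝ // B.IsSymm} in nhds ⟨Z, hsym⟩,
      ∀ i j, 0 < pairWeight (1 - 1 / (m : ℝ)) B.val i j := by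
    refine Filter.eventually_all.2 fun i => Filter.eventually_all.2 fun j => ?_
    refine ((continuous_pairWeight _ i j).comp continuous_subtype_val).continuousAt.eventually
      (lt_mem_nhds ?_)
    simpa only [Function.comp_apply, hZ] using pairWeight_one_add_ones_pos hm i j
  filter_upwards [hpos] with B hB
  exact isCSPlus_of_pairWeight_nonneg hc B.property fun i j => (hB i j).le
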